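/- For all session types T and S: T is a fair subtype of S if and only if (T, S) ∈ Gen(I_F, Ico_F), the interpretation of the generalized inference system for fair subtyping. -/

import Mathlib

/-- An inference system over a universe `U`: a set of rules `(premises, conclusion)`. -/
abbrev InfSys (U : Type) := Set (Set U × U)

/-- The (monotone) inference operator associated with an inference system. -/
def infOp {U : Type} (I : InfSys U) : Set U →o Set U where
  toFun X := {j | ∃ pr, pr ⊆ X ∧ (pr, j) ∈ I}
  monotone' := by
    intro X Y h j hj
    obtain ⟨pr, hpr, hr⟩ := hj
    exact ⟨pr, hpr.trans h, hr⟩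

/-- Inductive interpretation: least fixed point of the inference operator. -/
def Ind {U : Type} (I : InfSys U) : Set U := OrderHom.lfp (infOp I)

/-- Coinductive interpretation: greatest fixed point of the inference operator. -/
def CoInd {U : Type} (I : InfSys U) : Set U := OrderHom.gfp (infOp I)

/-- Interpretation of a generalized inference system `(I, Ico)`: the greatest
post-fixed point of `infOp I` included in `Ind (I ∪ Ico)`, i.e. the union of
all `X` with `X ⊆ infOp I X` and `X ⊆ Ind (I ∪ Ico)`. -/
def Gen {U : Type} (I Ico : InfSys U) : Set U :=
  sSup {X | X ⊆ infOp I X ∧ X ⊆ Ind (I ∪ Ico)}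

/-- Tags for the three constructors of session types. -/
inductive STag : Type | nil | inp | out

/-- The polynomial functor `X ↦ Unit ⊕ (V → X) ⊕ (V → X)`. -/
def STF (V : Type) : PFunctor.{0} := ⟨STag, fun t => match t with
  | .nil => Empty
  | .inp => V
  | .out => V⟩

/-- Session types over `V`: the final coalgebra (M-type) of `STF V`. -/
def SessionType (V : Type) : Type := (STF V).M

/-- The `nil` session type. -/
def SessionType.nil (V : Type) : SessionType V := PFunctor.M.mk ⟨STag.nil, Empty.elim⟩

/-- Input session type. -/
def SessionType.inp {V : Type} (f : V → SessionType V) : SessionType V :=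
  PFunctor.M.mk ⟨STag.inp, f⟩

/-- Output session type. -/
def SessionType.out {V : Type} (f : V → SessionType V) : SessionType V :=
  PFunctor.M.mk ⟨STag.out, f⟩

/-- Input/output actions `?x` and `!x`. -/
inductive Act (V : Type) : Type
  | inp (x : V)
  | out (x : V)

/-- Labeled transitions of session types:
`inp f −?x→ f x` for every `x`, and `out f −!x→ f x` for every `x ∈ dom f`. -/
inductive Transition {V : Type} : SessionType V → Act V → SessionType V → Prop
  | inp (f : V → SessionType V) (x : V) : Transition (.inp f) (.inp x) (f x)
  | out (f : V → SessionType V) (x : V) :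
      f x ≠ SessionType.nil V → Transition (.out f) (.out x) (f x)

/-- `TransSeq T φ S` means `T ⇒φ S` (composite of transitions along `φ`). -/
inductive TransSeq {V : Type} : SessionType V → List (Act V) → SessionType V → Prop
  | refl (T : SessionType V) : TransSeq T [] T
  | step {T T' S : SessionType V} {α : Act V} {φ : List (Act V)} :
      Transition T α T' → TransSeq T' φ S → TransSeq T (α :: φ) S

/-- Traces of a session type: `{φ | ∃ S ≠ nil, T ⇒φ S}`. -/
def Traces {V : Type} (T : SessionType V) : Set (List (Act V)) :=
  {φ | ∃ S, S ≠ SessionType.nil V ∧ TransSeq T φ S}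

/-- Fair termination: each trace extends to a maximal one. -/
def FairlyTerminating {V : Type} (T : SessionType V) : Prop :=
  ∀ φ ∈ Traces T, ∃ ψ, (φ ++ ψ) ∈ Traces T ∧ ∀ χ, ((φ ++ ψ) ++ χ) ∈ Traces T → χ = []

/-- Complementary action. -/
def coAct {V : Type} : Act V → Act V
  | .inp x => .out x
  | .out x => .inp x

/-- Reduction of sessions: client and server synchronize. -/
def Red {V : Type} (p q : SessionType V × SessionType V) : Prop :=
  ∃ α, Transition p.1 (coAct α) q.1 ∧ Transition p.2 α q.2

/-- Reflexive-transitive closure of session reduction. -/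
def Reds {V : Type} : SessionType V × SessionType V → SessionType V × SessionType V → Prop :=
  Relation.ReflTransGen Red

/-- A successful session: the client is `end!` and the server has not failed. -/
def Successful {V : Type} (p : SessionType V × SessionType V) : Prop :=
  (∃ f, p.1 = SessionType.out f ∧ ∀ x, f x = SessionType.nil V) ∧ p.2 ≠ SessionType.nil V

/-- A session may succeed if it reduces to a successful one. -/
def MaySucceed {V : Type} (p : SessionType V × SessionType V) : Prop :=
  ∃ q, Reds p q ∧ Successful q

/-- `R` is compliant with `S`: every stuck reduct is successful. -/
def Compliant {V : Type} (R S : SessionType V) : Prop :=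
  ∀ p, Reds (R, S) p → (∀ q, ¬ Red p q) → Successful p

/-- `R` is fairly compliant with `S`: every reduct may succeed. -/
def FairCompliant {V : Type} (R S : SessionType V) : Prop :=
  ∀ p, Reds (R, S) p → MaySucceed p

/-- Plain rules `I_F` of the fair-subtyping GIS (s-nil, s-end, s-inp, s-out). -/
def IF (V : Type) : InfSys (SessionType V × SessionType V) :=
  {r | ∃ T, r = (∅, (SessionType.nil V, T))} ∪
  {r | ∃ (f : V → SessionType V) (T : SessionType V),
        (∀ x, f x = SessionType.nil V) ∧ T ≠ SessionType.nil V ∧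
        (r = (∅, (SessionType.inp f, T)) ∨ r = (∅, (SessionType.out f, T)))} ∪
  {r | ∃ f g, (∃ x, f x ≠ SessionType.nil V) ∧
        (∀ x, f x ≠ SessionType.nil V → g x ≠ SessionType.nil V) ∧
        r = ({p | ∃ x, f x ≠ SessionType.nil V ∧ p = (f x, g x)},
             (SessionType.inp f, SessionType.inp g))} ∪
  {r | ∃ f g, (∃ x, g x ≠ SessionType.nil V) ∧
        (∀ x, g x ≠ SessionType.nil V → f x ≠ SessionType.nil V) ∧
        r = ({p | ∃ x, g x ≠ SessionType.nil V ∧ p = (f x, g x)},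
             (SessionType.out f, SessionType.out g))}

/-- Corules `Ico_F` of the fair-subtyping GIS (s-converge): all rules `(pr, (T, S))`
such that for every `φ ∈ traces T \ traces S` there are a prefix `ψ` of `φ` and a
value `x` with `ψ·!x ∈ traces T ∩ traces S` and `(T(ψ·!x), S(ψ·!x)) ∈ pr`. -/
def IcoF (V : Type) : InfSys (SessionType V × SessionType V) :=
  {r | ∀ φ ∈ Traces r.2.1, φ ∉ Traces r.2.2 →
        ∃ ψ x, ψ <+: φ ∧
          ∃ T' S', T' ≠ SessionType.nil V ∧ S' ≠ SessionType.nil V ∧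
            TransSeq r.2.1 (ψ ++ [Act.out x]) T' ∧
            TransSeq r.2.2 (ψ ++ [Act.out x]) S' ∧ (T', S') ∈ r.1}

/-- Subtyping: every compliant client of `T` is a compliant client of `S`. -/
def Subt {V : Type} (T S : SessionType V) : Prop :=
  ∀ R, Compliant R T → Compliant R S

/-- Fair subtyping: every fairly compliant client of `T` is one of `S`. -/
def FairSubt {V : Type} (T S : SessionType V) : Prop :=
  ∀ R, FairCompliant R T → FairCompliant R S

namespace SessionType

variable {V : Type}

theorem eq_nil_or_inp_or_out (T : SessionType V) :
    T = nil V ∨ (∃ f, T = inp f) ∨ ∃ f, T = out f := by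
  have h := PFunctor.M.mk_dest T
  rcases hd : PFunctor.M.dest T with ⟨t, f⟩
  rw [hd] at h
  cases t with
  | nil =>
    left
    rw [← h, nil, show f = Empty.elim from funext fun x : Empty => x.elim]
  | inp => exact Or.inr (Or.inl ⟨f, h.symm⟩)
  | out => exact Or.inr (Or.inr ⟨f, h.symm⟩)

@[simp] theorem inp_inj {f g : V → SessionType V} : inp f = inp g ↔ f = g := by
  refine ⟨fun h => ?_, fun h => h ▸ rfl⟩
  exact eq_of_heq (Sigma.mk.inj (PFunctor.M.mk_inj h)).2

@[simp] theorem out_inj {f g : V → SessionType V} : out f = out g ↔ f = g := by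
  refine ⟨fun h => ?_, fun h => h ▸ rfl⟩
  exact eq_of_heq (Sigma.mk.inj (PFunctor.M.mk_inj h)).2

@[simp] theorem inp_ne_nil {f : V → SessionType V} : inp f ≠ nil V := by
  intro h
  have := congrArg Sigma.fst (PFunctor.M.mk_inj h)
  simp at this

@[simp] theorem out_ne_nil {f : V → SessionType V} : out f ≠ nil V := by
  intro h
  have := congrArg Sigma.fst (PFunctor.M.mk_inj h)
  simp at this

@[simp] theorem inp_ne_out {f g : V → SessionType V} : inp f ≠ out g := by
  intro h
  have := congrArg Sigma.fst (PFunctor.M.mk_inj h)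
  simp at this

@[simp] theorem out_ne_inp {f g : V → SessionType V} : out f ≠ inp g :=
  inp_ne_out.symm

/-- The continuation selected by an action in an unfolded session type, `nil` if the action is not
enabled. -/
def continuation : STF V (SessionType V) → Act V → SessionType V
  | ⟨STag.inp, f⟩, Act.inp x => f x
  | ⟨STag.out, f⟩, Act.out x => f x
  | _, _ => nil V

/-- The residual of a session type after one action, `nil` if the action is not enabled. -/
def after (T : SessionType V) (α : Act V) : SessionType V :=
  continuation (PFunctor.M.dest T) α

theorem after_mk (t : STF V (SessionType V)) (α : Act V) :
    after (PFunctor.M.mk t) α = continuation t α :=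
  congrArg (continuation · α) (PFunctor.M.dest_mk t)

@[simp] theorem after_nil (α : Act V) : (nil V).after α = nil V :=
  after_mk _ _

@[simp] theorem after_inp_inp (f : V → SessionType V) (x : V) : (inp f).after (.inp x) = f x :=
  after_mk _ _

@[simp] theorem after_inp_out (f : V → SessionType V) (x : V) :
    (inp f).after (.out x) = nil V :=
  after_mk _ _

@[simp] theorem after_out_out (f : V → SessionType V) (x : V) : (out f).after (.out x) = f x :=
  after_mk _ _

@[simp] theorem after_out_inp (f : V → SessionType V) (x : V) :
    (out f).after (.inp x) = nil V :=
  after_mk _ _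

theorem transition_iff_after {T S : SessionType V} {α : Act V} (hS : S ≠ nil V) :
    Transition T α S ↔ T.after α = S := by
  constructor
  · rintro (⟨f, x⟩ | ⟨f, x, h⟩) <;> simp
  · rintro rfl
    rcases T.eq_nil_or_inp_or_out with rfl | ⟨f, rfl⟩ | ⟨f, rfl⟩ <;> rcases α with x | x <;>
      simp at hS ⊢
    · exact .inp f x
    · exact .out f x hS

theorem not_transition_nil {S : SessionType V} {α : Act V} : ¬ Transition (nil V) α S := by
  intro h
  generalize hT : nil V = T at h
  cases h with
  | inp f x => exact inp_ne_nil hT.symm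
  | out f x hx => exact out_ne_nil hT.symm

theorem foldl_after_nil (φ : List (Act V)) : φ.foldl after (nil V) = nil V := by
  induction φ with
  | nil => rfl
  | cons α φ ih => simpa using ih

theorem transSeq_iff_foldl {T S : SessionType V} {φ : List (Act V)} (hS : S ≠ nil V) :
    TransSeq T φ S ↔ φ.foldl after T = S := by
  induction φ generalizing T with
  | nil =>
    constructor
    · rintro ⟨⟩; rfl
    · rintro rfl; exact .refl _
  | cons α φ ih =>
    constructor
    · rintro (_ | ⟨h, h'⟩)
      have h1 := ih.1 h'
      rw [List.foldl_cons, (transition_iff_after ?_).1 h, h1]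
      rintro rfl
      exact hS (h1.symm.trans (foldl_after_nil φ))
    · intro h
      refine .step ((transition_iff_after ?_).2 rfl) (ih.2 h)
      intro h0
      rw [List.foldl_cons, h0, foldl_after_nil] at h
      exact hS h.symm

theorem mem_traces_iff {T : SessionType V} {φ : List (Act V)} :
    φ ∈ Traces T ↔ φ.foldl after T ≠ nil V := by
  constructor
  · rintro ⟨S, hS, h⟩
    rwa [(transSeq_iff_foldl hS).1 h]
  · intro h
    exact ⟨_, h, (transSeq_iff_foldl h).2 rfl⟩

end SessionType

open SessionType

section Sessions

variable {V : Type}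

@[simp] theorem transition_inp_iff {f : V → SessionType V} {α : Act V} {S : SessionType V} :
    Transition (.inp f) α S ↔ ∃ x, α = .inp x ∧ S = f x := by
  constructor
  · intro h
    generalize hT : SessionType.inp f = T at h
    cases h with
    | inp g x => obtain rfl := inp_inj.1 hT; exact ⟨x, rfl, rfl⟩
    | out g x => simp at hT
  · rintro ⟨x, rfl, rfl⟩
    exact .inp f x

@[simp] theorem transition_out_iff {f : V → SessionType V} {α : Act V} {S : SessionType V} :
    Transition (.out f) α S ↔ ∃ x, α = .out x ∧ f x ≠ .nil V ∧ S = f x := by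
  constructor
  · intro h
    generalize hT : SessionType.out f = T at h
    cases h with
    | inp g x => simp at hT
    | out g x hx => obtain rfl := out_inj.1 hT; exact ⟨x, rfl, hx, rfl⟩
  · rintro ⟨x, rfl, hx, rfl⟩
    exact .out f x hx

theorem red_out_inp_iff {h f : V → SessionType V} {q : SessionType V × SessionType V} :
    Red (.out h, .inp f) q ↔ ∃ x, h x ≠ .nil V ∧ q = (h x, f x) := by
  constructor
  · rintro ⟨α, h1, h2⟩
    obtain ⟨x, rfl, e2⟩ := transition_inp_iff.1 h2
    obtain ⟨y, e, hy, e1⟩ := transition_out_iff.1 h1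
    simp only [coAct, Act.out.injEq] at e
    subst e
    exact ⟨x, hy, Prod.ext e1 e2⟩
  · rintro ⟨x, hx, rfl⟩
    exact ⟨.inp x, .out h x hx, .inp f x⟩

theorem red_inp_out_iff {h f : V → SessionType V} {q : SessionType V × SessionType V} :
    Red (.inp h, .out f) q ↔ ∃ x, f x ≠ .nil V ∧ q = (h x, f x) := by
  constructor
  · rintro ⟨α, h1, h2⟩
    obtain ⟨x, rfl, hx, e2⟩ := transition_out_iff.1 h2
    obtain ⟨y, e, e1⟩ := transition_inp_iff.1 h1
    simp only [coAct, Act.inp.injEq] at e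
    subst e
    exact ⟨x, hx, Prod.ext e1 e2⟩
  · rintro ⟨x, hx, rfl⟩
    exact ⟨.out x, .inp h x, .out f x hx⟩

theorem not_red_inp_inp {h f : V → SessionType V} {q : SessionType V × SessionType V} :
    ¬ Red (.inp h, .inp f) q := by
  rintro ⟨α, h1, h2⟩
  obtain ⟨x, rfl, e2⟩ := transition_inp_iff.1 h2
  obtain ⟨y, e, e1⟩ := transition_inp_iff.1 h1
  simp [coAct] at e

theorem not_red_out_out {h f : V → SessionType V} {q : SessionType V × SessionType V} :
    ¬ Red (.out h, .out f) q := by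
  rintro ⟨α, h1, h2⟩
  obtain ⟨x, rfl, hx, e2⟩ := transition_out_iff.1 h2
  obtain ⟨y, e, hy, e1⟩ := transition_out_iff.1 h1
  simp [coAct] at e

theorem not_red_nil_left {S : SessionType V} {q : SessionType V × SessionType V} :
    ¬ Red (.nil V, S) q :=
  fun ⟨_, h, _⟩ => not_transition_nil h

theorem not_red_nil_right {R : SessionType V} {q : SessionType V × SessionType V} :
    ¬ Red (R, .nil V) q :=
  fun ⟨_, _, h⟩ => not_transition_nil h

theorem MaySucceed.cases {p : SessionType V × SessionType V} (h : MaySucceed p) :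
    Successful p ∨ ∃ q, Red p q ∧ MaySucceed q := by
  obtain ⟨r, hr, hs⟩ := h
  rcases Relation.ReflTransGen.cases_head hr with rfl | ⟨q, hq, hqr⟩
  · exact Or.inl hs
  · exact Or.inr ⟨q, hq, r, hqr, hs⟩

theorem MaySucceed.of_successful {p : SessionType V × SessionType V} (h : Successful p) :
    MaySucceed p :=
  ⟨p, .refl, h⟩

theorem MaySucceed.of_reds {p q : SessionType V × SessionType V} (h : Reds p q)
    (hq : MaySucceed q) : MaySucceed p := by
  obtain ⟨r, hr, hs⟩ := hq
  exact ⟨r, h.trans hr, hs⟩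

theorem MaySucceed.of_red {p q : SessionType V × SessionType V} (h : Red p q)
    (hq : MaySucceed q) : MaySucceed p :=
  hq.of_reds (.single h)

theorem successful_out {h : V → SessionType V} {S : SessionType V} (hh : ∀ x, h x = .nil V)
    (hS : S ≠ .nil V) : Successful (.out h, S) :=
  ⟨⟨h, rfl, hh⟩, hS⟩

theorem FairCompliant.maySucceed {R S : SessionType V} (h : FairCompliant R S) :
    MaySucceed (R, S) :=
  h _ .refl

theorem FairCompliant.of_reds {R S : SessionType V} {q : SessionType V × SessionType V}
    (h : FairCompliant R S) (hq : Reds (R, S) q) : FairCompliant q.1 q.2 :=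
  fun p hp => h p (hq.trans hp)

theorem FairCompliant.of_red {R S : SessionType V} {q : SessionType V × SessionType V}
    (h : FairCompliant R S) (hq : Red (R, S) q) : FairCompliant q.1 q.2 :=
  h.of_reds (.single hq)

/-- An invariant of reduction that guarantees possible success guarantees fair compliance. -/
theorem FairCompliant.of_invariant (P : SessionType V → SessionType V → Prop)
    (hsucc : ∀ R S, P R S → MaySucceed (R, S))
    (hstep : ∀ R S q, P R S → Red (R, S) q → P q.1 q.2) {R S : SessionType V} (h : P R S) :
    FairCompliant R S := by
  intro p hp
  have : P p.1 p.2 := by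
    induction hp with
    | refl => exact h
    | tail _ hr ih => exact hstep _ _ _ ih hr
  exact hsucc _ _ this

theorem FairCompliant.intro {R S : SessionType V} (h : MaySucceed (R, S))
    (hred : ∀ q, Red (R, S) q → FairCompliant q.1 q.2) : FairCompliant R S := by
  intro p hp
  rcases Relation.ReflTransGen.cases_head hp with rfl | ⟨q, hq, hqp⟩
  · exact h
  · exact hred q hq p hqp

theorem not_maySucceed_nil_left {S : SessionType V} : ¬ MaySucceed (.nil V, S) := by
  intro h
  rcases h.cases with ⟨⟨f, h, _⟩, _⟩ | ⟨q, hq, _⟩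
  · exact out_ne_nil h.symm
  · exact not_red_nil_left hq

theorem not_maySucceed_nil_right {R : SessionType V} : ¬ MaySucceed (R, .nil V) := by
  intro h
  rcases h.cases with ⟨_, h⟩ | ⟨q, hq, _⟩
  · exact h rfl
  · exact not_red_nil_right hq

theorem FairCompliant.left_ne_nil {R S : SessionType V} (h : FairCompliant R S) : R ≠ .nil V := by
  rintro rfl
  exact not_maySucceed_nil_left h.maySucceed

theorem FairCompliant.right_ne_nil {R S : SessionType V} (h : FairCompliant R S) :
    S ≠ .nil V := by
  rintro rfl
  exact not_maySucceed_nil_right h.maySucceed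

theorem fairCompliant_inp_iff {R : SessionType V} {f : V → SessionType V} :
    FairCompliant R (.inp f) ↔
      ∃ h, R = .out h ∧ ∀ x, h x ≠ .nil V → FairCompliant (h x) (f x) := by
  constructor
  · intro hc
    rcases R.eq_nil_or_inp_or_out with rfl | ⟨h, rfl⟩ | ⟨h, rfl⟩
    · exact absurd hc.maySucceed not_maySucceed_nil_left
    · rcases hc.maySucceed.cases with ⟨⟨k, hk, _⟩, _⟩ | ⟨q, hq, _⟩
      · exact absurd hk inp_ne_out
      · exact absurd hq not_red_inp_inp
    · exact ⟨h, rfl, fun x hx => hc.of_red (red_out_inp_iff.2 ⟨x, hx, rfl⟩)⟩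
  · rintro ⟨h, rfl, hh⟩
    refine .intro ?_ ?_
    · by_cases he : ∀ x, h x = .nil V
      · exact .of_successful (successful_out he inp_ne_nil)
      · push Not at he
        obtain ⟨x, hx⟩ := he
        exact (hh x hx).maySucceed.of_red (red_out_inp_iff.2 ⟨x, hx, rfl⟩)
    · intro q hq
      obtain ⟨x, hx, rfl⟩ := red_out_inp_iff.1 hq
      exact hh x hx

theorem fairCompliant_of_end {h : V → SessionType V} {S : SessionType V}
    (hh : ∀ x, h x = .nil V) (hS : S ≠ .nil V) : FairCompliant (.out h) S := by
  refine .intro (.of_successful (successful_out hh hS)) ?_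
  rintro q ⟨α, h1, -⟩
  obtain ⟨x, -, hx, -⟩ := transition_out_iff.1 h1
  exact absurd (hh x) hx

theorem fairCompliant_out_iff {R : SessionType V} {f : V → SessionType V} :
    FairCompliant R (.out f) ↔ (∃ h, R = .out h ∧ ∀ x, h x = .nil V) ∨
      ((∃ x, f x ≠ .nil V) ∧
        ∃ h, R = .inp h ∧ ∀ x, f x ≠ .nil V → FairCompliant (h x) (f x)) := by
  constructor
  · intro hc
    rcases hc.maySucceed.cases with ⟨h, -⟩ | ⟨q, hq, -⟩
    · exact Or.inl h
    · right
      rcases R.eq_nil_or_inp_or_out with rfl | ⟨h, rfl⟩ | ⟨h, rfl⟩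
      · exact absurd hq not_red_nil_left
      · obtain ⟨x, hx, -⟩ := red_inp_out_iff.1 hq
        exact ⟨⟨x, hx⟩, h, rfl, fun x hx => hc.of_red (red_inp_out_iff.2 ⟨x, hx, rfl⟩)⟩
      · exact absurd hq not_red_out_out
  · rintro (⟨h, rfl, hh⟩ | ⟨⟨x, hx⟩, h, rfl, hh⟩)
    · exact fairCompliant_of_end hh out_ne_nil
    · refine .intro ((hh x hx).maySucceed.of_red (red_inp_out_iff.2 ⟨x, hx, rfl⟩)) ?_
      intro q hq
      obtain ⟨y, hy, rfl⟩ := red_inp_out_iff.1 hq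
      exact hh y hy

theorem reds_iff_transSeq {R S R' S' : SessionType V} :
    Reds (R, S) (R', S') ↔ ∃ φ, TransSeq R (φ.map coAct) R' ∧ TransSeq S φ S' := by
  constructor
  · intro h
    generalize hp : (R, S) = p at h
    generalize hq : (R', S') = q at h
    induction h using Relation.ReflTransGen.head_induction_on generalizing R S with
    | refl =>
      obtain ⟨rfl, rfl⟩ := Prod.ext_iff.1 (hp.trans hq.symm)
      exact ⟨[], .refl _, .refl _⟩
    | @head p p' hr _ ih =>
      subst hp
      obtain ⟨α, h1, h2⟩ := hr
      obtain ⟨φ, h3, h4⟩ := @ih p'.1 p'.2 rfl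
      exact ⟨α :: φ, .step h1 h3, .step h2 h4⟩
  · rintro ⟨φ, h1, h2⟩
    induction φ generalizing R S with
    | nil => cases h1; cases h2; exact .refl
    | cons α φ ih =>
      cases h1 with | step a b =>
      cases h2 with | step c d =>
      exact .head ⟨α, a, c⟩ (ih b d)

theorem transSeq_append_iff {T S : SessionType V} {φ ψ : List (Act V)} :
    TransSeq T (φ ++ ψ) S ↔ ∃ U, TransSeq T φ U ∧ TransSeq U ψ S := by
  constructor
  · intro h
    induction φ generalizing T with
    | nil => exact ⟨T, .refl _, h⟩
    | cons α φ ih =>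
      cases h with | step a b =>
      obtain ⟨U, h1, h2⟩ := ih b
      exact ⟨U, .step a h1, h2⟩
  · rintro ⟨U, h1, h2⟩
    induction h1 with
    | refl => exact h2
    | step a _ ih => exact .step a (ih h2)

end Sessions

section Soundness

variable {V : Type}

/-- Derivability of `(T, S)` from `X` by one plain rule. -/
theorem mem_infOp_IF_iff {X : Set (SessionType V × SessionType V)} {T S : SessionType V} :
    (T, S) ∈ infOp (IF V) X ↔
      T = .nil V ∨
      (S ≠ .nil V ∧ ∃ f, (∀ x, f x = .nil V) ∧ (T = .inp f ∨ T = .out f)) ∨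
      (∃ f g, T = .inp f ∧ S = .inp g ∧ (∃ x, f x ≠ .nil V) ∧
        ∀ x, f x ≠ .nil V → g x ≠ .nil V ∧ (f x, g x) ∈ X) ∨
      (∃ f g, T = .out f ∧ S = .out g ∧ (∃ x, g x ≠ .nil V) ∧
        ∀ x, g x ≠ .nil V → f x ≠ .nil V ∧ (f x, g x) ∈ X) := by
  constructor
  · rintro ⟨pr, hpr, ((⟨T', h⟩ | ⟨f, T', hf, hT, h⟩) | ⟨f, g, hx, hfg, h⟩) | ⟨f, g, hx, hfg, h⟩⟩
    · simp only [Prod.mk.injEq] at h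
      exact Or.inl h.2.1
    · simp only [Prod.mk.injEq] at h
      refine Or.inr (Or.inl ?_)
      rcases h with ⟨-, h, rfl⟩ | ⟨-, h, rfl⟩
      · exact ⟨hT, f, hf, Or.inl h⟩
      · exact ⟨hT, f, hf, Or.inr h⟩
    · simp only [Prod.mk.injEq] at h
      obtain ⟨rfl, hT, hS⟩ := h
      exact Or.inr (Or.inr (Or.inl ⟨f, g, hT, hS, hx,
        fun x hx => ⟨hfg x hx, hpr ⟨x, hx, rfl⟩⟩⟩))
    · simp only [Prod.mk.injEq] at h
      obtain ⟨rfl, hT, hS⟩ := h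
      exact Or.inr (Or.inr (Or.inr ⟨f, g, hT, hS, hx,
        fun x hx => ⟨hfg x hx, hpr ⟨x, hx, rfl⟩⟩⟩))
  · rintro (rfl | ⟨hS, f, hf, h⟩ | ⟨f, g, rfl, rfl, hx, h⟩ | ⟨f, g, rfl, rfl, hx, h⟩)
    · exact ⟨∅, Set.empty_subset _, Or.inl (Or.inl (Or.inl ⟨S, rfl⟩))⟩
    · refine ⟨∅, Set.empty_subset _, Or.inl (Or.inl (Or.inr ⟨f, S, hf, hS, ?_⟩))⟩
      rcases h with rfl | rfl
      · exact Or.inl rfl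
      · exact Or.inr rfl
    · refine ⟨_, ?_, Or.inl (Or.inr ⟨f, g, hx, fun x hx => (h x hx).1, rfl⟩)⟩
      rintro _ ⟨x, hx, rfl⟩
      exact (h x hx).2
    · refine ⟨_, ?_, Or.inr ⟨f, g, hx, fun x hx => (h x hx).1, rfl⟩⟩
      rintro _ ⟨x, hx, rfl⟩
      exact (h x hx).2

/-- The only clients of a terminated server are terminated. -/
theorem FairCompliant.eq_end {R : SessionType V} {f : V → SessionType V}
    (hf : ∀ x, f x = .nil V) (h : FairCompliant R (.inp f) ∨ FairCompliant R (.out f)) :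
    ∃ k, R = .out k ∧ ∀ x, k x = .nil V := by
  rcases h with h | h
  · obtain ⟨k, rfl, hk⟩ := fairCompliant_inp_iff.1 h
    refine ⟨k, rfl, fun x => ?_⟩
    by_contra hx
    exact (hk x hx).right_ne_nil (hf x)
  · rcases fairCompliant_out_iff.1 h with h | ⟨⟨x, hx⟩, -⟩
    · exact h
    · exact absurd (hf x) hx

/-- The pairs of servers for which fair compliance with the first one implies
possible success with the second one. -/
def successPreserving (V : Type) : Set (SessionType V × SessionType V) :=
  {p | ∀ R, FairCompliant R p.1 → MaySucceed (R, p.2)}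

theorem infOp_IF_successPreserving_subset :
    infOp (IF V) (successPreserving V) ⊆ successPreserving V := by
  rintro ⟨T, S⟩ hTS R (hR : FairCompliant R T)
  change MaySucceed (R, S)
  rcases mem_infOp_IF_iff.1 hTS with
    rfl | ⟨hS, f, hf, h⟩ | ⟨f, g, rfl, rfl, ⟨x, hx⟩, h⟩ | ⟨f, g, rfl, rfl, ⟨x, hx⟩, h⟩
  · exact absurd rfl hR.right_ne_nil
  · have : FairCompliant R (.inp f) ∨ FairCompliant R (.out f) := by
      rcases h with rfl | rfl
      · exact Or.inl hR
      · exact Or.inr hR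
    obtain ⟨k, rfl, hk⟩ := FairCompliant.eq_end hf this
    exact .of_successful (successful_out hk hS)
  · obtain ⟨k, rfl, hk⟩ := fairCompliant_inp_iff.1 hR
    by_cases he : ∀ x, k x = .nil V
    · exact .of_successful (successful_out he inp_ne_nil)
    · push Not at he
      obtain ⟨y, hy⟩ := he
      have hc := hk y hy
      exact ((h y hc.right_ne_nil).2 _ hc).of_red (red_out_inp_iff.2 ⟨y, hy, rfl⟩)
  · rcases fairCompliant_out_iff.1 hR with ⟨k, rfl, hk⟩ | ⟨-, k, rfl, hk⟩
    · exact .of_successful (successful_out hk out_ne_nil)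
    · exact ((h x hx).2 _ (hk x (h x hx).1)).of_red (red_inp_out_iff.2 ⟨x, hx, rfl⟩)

theorem infOp_IcoF_successPreserving_subset :
    infOp (IcoF V) (successPreserving V) ⊆ successPreserving V := by
  rintro ⟨T, S⟩ ⟨pr, hpr, hrule⟩ R (hR : FairCompliant R T)
  change MaySucceed (R, S)
  obtain ⟨⟨R₁, T₁⟩, hred, hend, hT₁⟩ := hR.maySucceed
  obtain ⟨φ, hRφ, hTφ⟩ := reds_iff_transSeq.1 hred
  by_cases hS : φ ∈ Traces S
  · obtain ⟨S₁, hS₁, hSφ⟩ := hS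
    exact ⟨(R₁, S₁), reds_iff_transSeq.2 ⟨φ, hRφ, hSφ⟩, hend, hS₁⟩
  · obtain ⟨ψ, x, ⟨χ, rfl⟩, T', S', hT', hS', hTx, hSx, hmem⟩ := hrule φ ⟨T₁, hT₁, hTφ⟩ hS
    rw [List.map_append] at hRφ
    obtain ⟨R₂, hRψ, -⟩ := transSeq_append_iff.1 hRφ
    obtain ⟨T₂, hTψ, hTx⟩ := transSeq_append_iff.1 hTx
    obtain ⟨S₂, hSψ, hSx⟩ := transSeq_append_iff.1 hSx
    have hc : FairCompliant R₂ T₂ := hR.of_reds (reds_iff_transSeq.2 ⟨ψ, hRψ, hTψ⟩)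
    refine MaySucceed.of_reds (reds_iff_transSeq.2 ⟨ψ, hRψ, hSψ⟩) ?_
    cases hTx with | step a b =>
    cases b
    cases hSx with | step c d =>
    cases d
    cases a with | out f _ hf =>
    generalize hU : Act.out x = α at c
    cases c with
    | inp => cases hU
    | out g y hg =>
      cases hU
      rcases fairCompliant_out_iff.1 hc with ⟨k, rfl, hk⟩ | ⟨-, k, rfl, hk⟩
      · exact .of_successful (successful_out hk out_ne_nil)
      · exact (hpr hmem _ (hk x hf)).of_red (red_inp_out_iff.2 ⟨x, hg, rfl⟩)

theorem ind_subset_successPreserving : Ind (IF V ∪ IcoF V) ⊆ successPreserving V := by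
  refine OrderHom.lfp_le _ ?_
  rintro j ⟨pr, hpr, h | h⟩
  · exact infOp_IF_successPreserving_subset ⟨pr, hpr, h⟩
  · exact infOp_IcoF_successPreserving_subset ⟨pr, hpr, h⟩

theorem fairSubt_of_postfixed {X : Set (SessionType V × SessionType V)}
    (hX : X ⊆ infOp (IF V) X) (hInd : X ⊆ Ind (IF V ∪ IcoF V)) {T S : SessionType V}
    (hTS : (T, S) ∈ X) : FairSubt T S := by
  intro R hR
  refine FairCompliant.of_invariant (fun R S => ∃ T, (T, S) ∈ X ∧ FairCompliant R T) ?_ ?_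
    ⟨T, hTS, hR⟩
  · rintro R S ⟨T, hTS, hR⟩
    exact ind_subset_successPreserving (hInd hTS) R hR
  · rintro R S q ⟨T, hTS, hR⟩ hq
    rcases mem_infOp_IF_iff.1 (hX hTS) with
      rfl | ⟨hS, f, hf, h⟩ | ⟨f, g, rfl, rfl, -, h⟩ | ⟨f, g, rfl, rfl, -, h⟩
    · exact absurd rfl hR.right_ne_nil
    · have : FairCompliant R (.inp f) ∨ FairCompliant R (.out f) := by
        rcases h with rfl | rfl
        · exact Or.inl hR
        · exact Or.inr hR
      obtain ⟨k, rfl, hk⟩ := FairCompliant.eq_end hf this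
      obtain ⟨α, h1, -⟩ := hq
      obtain ⟨x, -, hx, -⟩ := transition_out_iff.1 h1
      exact absurd (hk x) hx
    · obtain ⟨k, rfl, hk⟩ := fairCompliant_inp_iff.1 hR
      obtain ⟨x, hx, rfl⟩ := red_out_inp_iff.1 hq
      exact ⟨f x, (h x (hk x hx).right_ne_nil).2, hk x hx⟩
    · rcases fairCompliant_out_iff.1 hR with ⟨k, rfl, hk⟩ | ⟨-, k, rfl, hk⟩
      · exact absurd hq not_red_out_out
      · obtain ⟨x, hx, rfl⟩ := red_inp_out_iff.1 hq
        exact ⟨f x, (h x hx).2, hk x (h x hx).1⟩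

end Soundness

section Completeness

variable {V : Type}

/-- The pairs of servers related by fair subtyping. -/
def fairSubtPairs (V : Type) : Set (SessionType V × SessionType V) :=
  {p | FairSubt p.1 p.2}

theorem FairSubt.right_ne_nil {T S : SessionType V} (h : FairSubt T S) (hT : T ≠ .nil V) :
    S ≠ .nil V :=
  (h _ (fairCompliant_of_end (fun _ => rfl) hT)).right_ne_nil

open Classical in
theorem FairSubt.of_inp {f : V → SessionType V} {S : SessionType V} (h : FairSubt (.inp f) S)
    (hf : ∃ x, f x ≠ .nil V) :
    ∃ g, S = .inp g ∧ ∀ x, f x ≠ .nil V → g x ≠ .nil V ∧ FairSubt (f x) (g x) := by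
  have key : ∀ x R, FairCompliant R (f x) →
      FairCompliant (.out fun y => if y = x then R else .nil V) S := by
    intro x R hR
    refine h _ (fairCompliant_inp_iff.2 ⟨_, rfl, fun y hy => ?_⟩)
    by_cases hyx : y = x
    · subst hyx; simpa using hR
    · simp [hyx] at hy
  obtain ⟨x, hx⟩ := hf
  rcases S.eq_nil_or_inp_or_out with rfl | ⟨g, rfl⟩ | ⟨g, rfl⟩
  · exact absurd rfl (h.right_ne_nil inp_ne_nil)
  · have sub : ∀ x, FairSubt (f x) (g x) := by
      intro x R hR
      obtain ⟨k, e, hk⟩ := fairCompliant_inp_iff.1 (key x R hR)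
      obtain rfl := out_inj.1 e
      have := hk x
      simp only [if_true] at this
      exact this hR.left_ne_nil
    exact ⟨g, rfl, fun x hx => ⟨(sub x).right_ne_nil hx, sub x⟩⟩
  · rcases fairCompliant_out_iff.1
      (key x (.out fun _ => .nil V) (fairCompliant_of_end (fun _ => rfl) hx)) with
      ⟨k, e, hk⟩ | ⟨-, k, e, -⟩
    · obtain rfl := out_inj.1 e
      simpa using hk x
    · exact absurd e out_ne_inp

open Classical in
theorem FairSubt.of_out {f : V → SessionType V} {S : SessionType V} (h : FairSubt (.out f) S)
    (hf : ∃ x, f x ≠ .nil V) :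
    ∃ g, S = .out g ∧ (∃ x, g x ≠ .nil V) ∧
      ∀ x, g x ≠ .nil V → f x ≠ .nil V ∧ FairSubt (f x) (g x) := by
  have key : ∀ x R, (f x ≠ .nil V → FairCompliant R (f x)) →
      FairCompliant (.inp fun y => if y = x then R else
        if f y = .nil V then .nil V else .out fun _ => .nil V) S := by
    intro x R hR
    refine h _ (fairCompliant_out_iff.2 (Or.inr ⟨hf, _, rfl, fun y hy => ?_⟩))
    by_cases hyx : y = x
    · subst hyx; simpa using hR hy
    · simpa [hyx, hy] using fairCompliant_of_end (fun _ => rfl) hy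
  have key' : ∀ x R, (f x ≠ .nil V → FairCompliant R (f x)) → ∃ g, S = .out g ∧
      (∃ x, g x ≠ .nil V) ∧ (g x ≠ .nil V → FairCompliant R (g x)) := by
    intro x R hR
    have hc := key x R hR
    rcases S.eq_nil_or_inp_or_out with rfl | ⟨g, rfl⟩ | ⟨g, rfl⟩
    · exact absurd rfl (h.right_ne_nil out_ne_nil)
    · obtain ⟨k, e, -⟩ := fairCompliant_inp_iff.1 hc
      exact absurd e inp_ne_out
    · rcases fairCompliant_out_iff.1 hc with ⟨k, e, -⟩ | ⟨hg, k, e, hk⟩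
      · exact absurd e inp_ne_out
      · obtain rfl := inp_inj.1 e
        exact ⟨g, rfl, hg, fun hx => by simpa using hk x hx⟩
  obtain ⟨x, hx⟩ := hf
  obtain ⟨g, rfl, hg, -⟩ := key' x (.out fun _ => .nil V)
    (fairCompliant_of_end fun _ => rfl)
  refine ⟨g, rfl, hg, fun y hy => ⟨fun h0 => ?_, fun R hR => ?_⟩⟩
  · obtain ⟨g', e, -, hc⟩ := key' y (.nil V) (fun hn => absurd h0 hn)
    obtain rfl := out_inj.1 e
    exact (hc hy).left_ne_nil rfl
  · obtain ⟨g', e, -, hc⟩ := key' y R (fun _ => hR)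
    obtain rfl := out_inj.1 e
    exact hc hy

theorem fairSubtPairs_postfixed : fairSubtPairs V ⊆ infOp (IF V) (fairSubtPairs V) := by
  rintro ⟨T, S⟩ (h : FairSubt T S)
  rw [mem_infOp_IF_iff]
  rcases T.eq_nil_or_inp_or_out with rfl | ⟨f, rfl⟩ | ⟨f, rfl⟩
  · exact Or.inl rfl
  · by_cases hf : ∃ x, f x ≠ .nil V
    · obtain ⟨g, rfl, hg⟩ := h.of_inp hf
      exact Or.inr (Or.inr (Or.inl ⟨f, g, rfl, rfl, hf, hg⟩))
    · push Not at hf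
      exact Or.inr (Or.inl ⟨h.right_ne_nil inp_ne_nil, f, hf, Or.inl rfl⟩)
  · by_cases hf : ∃ x, f x ≠ .nil V
    · obtain ⟨g, rfl, hg⟩ := h.of_out hf
      exact Or.inr (Or.inr (Or.inr ⟨f, g, rfl, rfl, hg⟩))
    · push Not at hf
      exact Or.inr (Or.inl ⟨h.right_ne_nil out_ne_nil, f, hf, Or.inr rfl⟩)

/-- `φ` refutes the corule with premises `A` and conclusion `(T, S)`. -/
def Diverges (A : Set (SessionType V × SessionType V)) (T S : SessionType V)
    (φ : List (Act V)) : Prop :=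
  φ.foldl after T ≠ .nil V ∧ φ.foldl after S = .nil V ∧
    ∀ ψ x, ψ <+: φ → (ψ ++ [Act.out x]).foldl after T ≠ .nil V →
      (ψ ++ [Act.out x]).foldl after S ≠ .nil V →
      ((ψ ++ [Act.out x]).foldl after T, (ψ ++ [Act.out x]).foldl after S) ∉ A

theorem Diverges.tail {A : Set (SessionType V × SessionType V)} {T S : SessionType V}
    {α : Act V} {φ : List (Act V)} (h : Diverges A T S (α :: φ)) :
    Diverges A (T.after α) (S.after α) φ :=
  ⟨h.1, h.2.1, fun ψ x hψ => h.2.2 (α :: ψ) x (List.cons_prefix_cons.2 ⟨rfl, hψ⟩)⟩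

theorem exists_diverges_of_notMem_ind {T S : SessionType V}
    (h : (T, S) ∉ Ind (IF V ∪ IcoF V)) : ∃ φ, Diverges (Ind (IF V ∪ IcoF V)) T S φ := by
  by_contra hno
  apply h
  have hfix : infOp (IF V ∪ IcoF V) (Ind (IF V ∪ IcoF V)) = Ind (IF V ∪ IcoF V) :=
    OrderHom.map_lfp _
  rw [← hfix]
  refine ⟨_, subset_rfl, Or.inr ?_⟩
  intro φ hT hS
  rw [mem_traces_iff] at hT hS
  by_contra hne
  refine hno ⟨φ, hT, not_not.1 hS, fun ψ x hψ h1 h2 hmem => hne ?_⟩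
  exact ⟨ψ, x, hψ, _, _, h1, h2, (transSeq_iff_foldl h1).2 rfl, (transSeq_iff_foldl h2).2 rfl,
    hmem⟩

theorem diverges_nil {A : Set (SessionType V × SessionType V)} {T : SessionType V}
    (hT : T ≠ .nil V) : Diverges A T (.nil V) [] :=
  ⟨hT, rfl, fun _ _ _ _ h => absurd (foldl_after_nil _) h⟩

/-- States of the discriminating client: two servers and the trace still to be followed;
`none` stands for `nil`. -/
abbrev ClientState (V : Type) : Type :=
  Option (SessionType V × SessionType V × List (Act V))

open Classical in
/-- One step of the discriminating client: it follows the given trace, and when the server takes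
another branch it restarts with the trace that `w` provides for that branch. -/
noncomputable def clientStep (w : SessionType V → SessionType V → List (Act V)) :
    ClientState V → STF V (ClientState V)
  | none => ⟨STag.nil, Empty.elim⟩
  | some (_, _, []) => ⟨STag.out, fun (_ : V) => none⟩
  | some (T, S, .out x :: φ) => ⟨STag.inp, fun (y : V) =>
      if y = x then some (T.after (.out y), S.after (.out y), φ)
      else if T.after (.out y) = .nil V then none
      else some (T.after (.out y), S.after (.out y), w (T.after (.out y)) (S.after (.out y)))⟩
  | some (T, S, .inp x :: φ) => ⟨STag.out, fun (y : V) =>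
      if y = x then some (T.after (.inp y), S.after (.inp y), φ) else none⟩

/-- The client that tells two servers apart. -/
noncomputable def client (w : SessionType V → SessionType V → List (Act V))
    (s : ClientState V) : SessionType V :=
  PFunctor.M.corec (clientStep w) s

theorem client_eq_mk (w : SessionType V → SessionType V → List (Act V)) (s : ClientState V) :
    client w s = PFunctor.M.mk ((STF V).map (client w) (clientStep w s)) := by
  rw [← PFunctor.M.mk_dest (client w s), client, PFunctor.M.dest_corec]
  rfl

variable {w : SessionType V → SessionType V → List (Act V)}

theorem client_none : client w none = .nil V := by
  rw [client_eq_mk]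
  simp only [clientStep, PFunctor.map, SessionType.nil]
  congr 2
  funext x
  exact x.elim

theorem client_nil (T S : SessionType V) :
    client w (some (T, S, [])) = .out fun _ => .nil V := by
  rw [client_eq_mk, ← client_none (w := w)]
  rfl

theorem client_inp (T S : SessionType V) (x : V) (φ : List (Act V)) :
    ∃ h, client w (some (T, S, .inp x :: φ)) = .out h ∧
      h x = client w (some (T.after (.inp x), S.after (.inp x), φ)) ∧
      ∀ y, y ≠ x → h y = .nil V := by
  classical
  refine ⟨_, client_eq_mk _ _, ?_, fun y hy => ?_⟩
  · exact congrArg (client w) (if_pos rfl)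
  · exact (congrArg (client w) (if_neg hy)).trans client_none

theorem client_out (T S : SessionType V) (x : V) (φ : List (Act V)) :
    ∃ h, client w (some (T, S, .out x :: φ)) = .inp h ∧
      h x = client w (some (T.after (.out x), S.after (.out x), φ)) ∧
      ∀ y, y ≠ x → T.after (.out y) ≠ .nil V → h y = client w
        (some (T.after (.out y), S.after (.out y), w (T.after (.out y)) (S.after (.out y)))) := by
  classical
  refine ⟨_, client_eq_mk _ _, ?_, fun y hy hT => ?_⟩
  · exact congrArg (client w) (if_pos rfl)
  · exact congrArg (client w) ((if_neg hy).trans (if_neg hT))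

theorem client_some_ne_nil (T S : SessionType V) (φ : List (Act V)) :
    client w (some (T, S, φ)) ≠ .nil V := by
  match φ with
  | [] => rw [client_nil]; exact out_ne_nil
  | .inp x :: φ => obtain ⟨h, e, -⟩ := client_inp (w := w) T S x φ; rw [e]; exact out_ne_nil
  | .out x :: φ => obtain ⟨h, e, -⟩ := client_out (w := w) T S x φ; rw [e]; exact inp_ne_nil

theorem exists_eq_inp_of_foldl {T : SessionType V} {x : V} {φ : List (Act V)}
    (h : (Act.inp x :: φ).foldl after T ≠ .nil V) : ∃ f, T = .inp f ∧ f x ≠ .nil V := by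
  have hx : T.after (.inp x) ≠ .nil V := fun h0 => h (by simp [h0, foldl_after_nil])
  rcases T.eq_nil_or_inp_or_out with rfl | ⟨f, rfl⟩ | ⟨f, rfl⟩ <;> simp at hx
  exact ⟨f, rfl, hx⟩

theorem exists_eq_out_of_foldl {T : SessionType V} {x : V} {φ : List (Act V)}
    (h : (Act.out x :: φ).foldl after T ≠ .nil V) : ∃ f, T = .out f ∧ f x ≠ .nil V := by
  have hx : T.after (.out x) ≠ .nil V := fun h0 => h (by simp [h0, foldl_after_nil])
  rcases T.eq_nil_or_inp_or_out with rfl | ⟨f, rfl⟩ | ⟨f, rfl⟩ <;> simp at hx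
  exact ⟨f, rfl, hx⟩

theorem client_maySucceed {T S : SessionType V} {φ : List (Act V)}
    (h : φ.foldl after T ≠ .nil V) : MaySucceed (client w (some (T, S, φ)), T) := by
  induction φ generalizing T S with
  | nil =>
    rw [client_nil]
    exact .of_successful (successful_out (fun _ => rfl) h)
  | cons α φ ih =>
    refine MaySucceed.of_red ?_ (ih (S := S.after α) h)
    rcases α with x | x
    · obtain ⟨f, rfl, hx⟩ := exists_eq_inp_of_foldl h
      obtain ⟨k, e, ek, -⟩ := client_inp (w := w) (.inp f) S x φ
      rw [e, red_out_inp_iff]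
      exact ⟨x, by rw [ek]; exact client_some_ne_nil _ _ _, by rw [ek, after_inp_inp]⟩
    · obtain ⟨f, rfl, hx⟩ := exists_eq_out_of_foldl h
      obtain ⟨k, e, ek, -⟩ := client_out (w := w) (.out f) S x φ
      rw [e, red_inp_out_iff]
      exact ⟨x, hx, by rw [ek, after_out_out]⟩

variable {A : Set (SessionType V × SessionType V)}

/-- Branches off a diverging trace are again equipped with diverging traces. -/
theorem Diverges.branch
    (hw : ∀ T S, (∃ φ, Diverges A T S φ) → Diverges A T S (w T S))
    (hA : ∀ T S, (T, S) ∉ A → ∃ φ, Diverges A T S φ) {T S : SessionType V} {φ : List (Act V)}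
    (h : Diverges A T S φ) {y : V} (hy : T.after (.out y) ≠ .nil V) :
    Diverges A (T.after (.out y)) (S.after (.out y))
      (w (T.after (.out y)) (S.after (.out y))) := by
  apply hw
  by_cases hS : S.after (.out y) = .nil V
  · rw [hS]
    exact ⟨[], diverges_nil hy⟩
  · exact hA _ _ (h.2.2 [] y List.nil_prefix hy hS)

theorem client_fairCompliant
    (hw : ∀ T S, (∃ φ, Diverges A T S φ) → Diverges A T S (w T S))
    (hA : ∀ T S, (T, S) ∉ A → ∃ φ, Diverges A T S φ) {T S : SessionType V} {φ : List (Act V)}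
    (h : Diverges A T S φ) : FairCompliant (client w (some (T, S, φ))) T := by
  refine FairCompliant.of_invariant
    (fun R T => ∃ S φ, R = client w (some (T, S, φ)) ∧ Diverges A T S φ) ?_ ?_ ⟨S, φ, rfl, h⟩
  · rintro R T ⟨S, φ, rfl, h⟩
    exact client_maySucceed h.1
  · rintro R T q ⟨S, φ, rfl, h⟩ hq
    match φ with
    | [] =>
      rw [client_nil] at hq
      obtain ⟨α, h1, -⟩ := hq
      simp at h1
    | .inp x :: φ =>
      obtain ⟨f, rfl, hx⟩ := exists_eq_inp_of_foldl h.1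
      obtain ⟨k, e, ek, hk⟩ := client_inp (w := w) (.inp f) S x φ
      rw [e] at hq
      obtain ⟨y, hy, rfl⟩ := red_out_inp_iff.1 hq
      obtain rfl : y = x := by
        by_contra hne
        exact hy (hk y hne)
      have ht := h.tail
      rw [after_inp_inp] at ht ek
      exact ⟨_, φ, ek, ht⟩
    | .out x :: φ =>
      obtain ⟨f, rfl, hx⟩ := exists_eq_out_of_foldl h.1
      obtain ⟨k, e, ek, hk⟩ := client_out (w := w) (.out f) S x φ
      rw [e] at hq
      obtain ⟨y, hy, rfl⟩ := red_inp_out_iff.1 hq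
      by_cases hne : y = x
      · subst hne
        have ht := h.tail
        rw [after_out_out] at ht ek
        exact ⟨_, φ, ek, ht⟩
      · have hy' : (SessionType.out f).after (.out y) ≠ .nil V := by rwa [after_out_out]
        have hb := h.branch hw hA hy'
        have hk' := hk y hne hy'
        rw [after_out_out] at hb hk'
        exact ⟨_, _, hk', hb⟩

theorem client_not_maySucceed
    (hw : ∀ T S, (∃ φ, Diverges A T S φ) → Diverges A T S (w T S))
    (hA : ∀ T S, (T, S) ∉ A → ∃ φ, Diverges A T S φ) {T S : SessionType V} {φ : List (Act V)}
    (h : Diverges A T S φ) (hsub : FairSubt T S) :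
    ¬ MaySucceed (client w (some (T, S, φ)), S) := by
  rintro ⟨q, hq, hsucc⟩
  have hinv : ∃ T φ, q.1 = client w (some (T, q.2, φ)) ∧ Diverges A T q.2 φ ∧
      FairSubt T q.2 := by
    clear hsucc
    induction hq with
    | refl => exact ⟨T, φ, rfl, h, hsub⟩
    | @tail p q _ hr ih =>
      clear h hsub
      obtain ⟨R, S⟩ := p
      obtain ⟨T, φ, e, h, hsub⟩ := ih
      simp only at e h hsub
      subst e
      match φ with
      | [] =>
        rw [client_nil] at hr
        obtain ⟨α, h1, -⟩ := hr
        simp at h1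
      | .inp x :: φ =>
        obtain ⟨f, rfl, hx⟩ := exists_eq_inp_of_foldl h.1
        obtain ⟨g, rfl, hg⟩ := hsub.of_inp ⟨x, hx⟩
        obtain ⟨k, e, ek, hk⟩ := client_inp (w := w) (.inp f) (.inp g) x φ
        rw [e] at hr
        obtain ⟨y, hy, rfl⟩ := red_out_inp_iff.1 hr
        obtain rfl : y = x := by
          by_contra hne
          exact hy (hk y hne)
        have ht := h.tail
        rw [after_inp_inp, after_inp_inp] at ht ek
        exact ⟨_, φ, ek, ht, (hg y hx).2⟩
      | .out x :: φ =>
        obtain ⟨f, rfl, hx⟩ := exists_eq_out_of_foldl h.1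
        obtain ⟨g, rfl, -, hg⟩ := hsub.of_out ⟨x, hx⟩
        obtain ⟨k, e, ek, hk⟩ := client_out (w := w) (.out f) (.out g) x φ
        rw [e] at hr
        obtain ⟨y, hy, rfl⟩ := red_inp_out_iff.1 hr
        by_cases hne : y = x
        · subst hne
          have ht := h.tail
          rw [after_out_out, after_out_out] at ht ek
          exact ⟨_, φ, ek, ht, (hg y hy).2⟩
        · have hy' : (SessionType.out f).after (.out y) ≠ .nil V := by
            rw [after_out_out]
            exact (hg y hy).1
          have hb := h.branch hw hA hy'
          have hk' := hk y hne hy'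
          rw [after_out_out, after_out_out] at hb hk'
          exact ⟨_, _, hk', hb, (hg y hy).2⟩
  obtain ⟨T, φ, e, h, -⟩ := hinv
  obtain ⟨⟨k, ek, hk⟩, hS⟩ := hsucc
  match φ with
  | [] => exact hS h.2.1
  | .inp x :: φ =>
    obtain ⟨k', e', ex, -⟩ := client_inp (w := w) T q.2 x φ
    obtain rfl := out_inj.1 (ek.symm.trans (e.trans e'))
    exact client_some_ne_nil _ _ _ (ex.symm.trans (hk x))
  | .out x :: φ =>
    obtain ⟨k', e', -⟩ := client_out (w := w) T q.2 x φ
    exact out_ne_inp (ek.symm.trans (e.trans e'))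

theorem fairSubtPairs_subset_ind : fairSubtPairs V ⊆ Ind (IF V ∪ IcoF V) := by
  classical
  rintro ⟨T, S⟩ (hsub : FairSubt T S)
  by_contra hTS
  let A := Ind (IF V ∪ IcoF V)
  have hA : ∀ T S, (T, S) ∉ A → ∃ φ, Diverges A T S φ := fun _ _ =>
    exists_diverges_of_notMem_ind
  let w : SessionType V → SessionType V → List (Act V) := fun T S =>
    if h : ∃ φ, Diverges A T S φ then h.choose else []
  have hw : ∀ T S, (∃ φ, Diverges A T S φ) → Diverges A T S (w T S) := by
    intro T S h
    simp only [w, dif_pos h]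
    exact h.choose_spec
  obtain ⟨φ, hφ⟩ := hA T S hTS
  exact client_not_maySucceed hw hA hφ hsub (hsub _ (client_fairCompliant hw hA hφ)).maySucceed

end Completeness

/-- Fair subtyping coincides with the interpretation of the generalized
inference system for fair subtyping. -/
theorem stmt18 {V : Type} [Nontrivial V] (T S : SessionType V) :
    FairSubt T S ↔ (T, S) ∈ Gen (IF V) (IcoF V) := by
  constructor
  · intro h
    exact ⟨fairSubtPairs V, ⟨fairSubtPairs_postfixed, fairSubtPairs_subset_ind⟩, h⟩
  · rintro ⟨X, ⟨hX, hInd⟩, hTS⟩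
    exact fairSubt_of_postfixed hX hInd hTS
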